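/- arXiv:1707.04783 — 2 statements merged into one kernel-verified Lean document; each statement's English description precedes it below -/
import Mathlib

section
/- Let 0 < j < 3^n − 1 with ternary digits j_i. Suppose j ∈ S_1, {j_0, j_{(n−k) mod n}} = {1, 2}, and {j_1, j_{(1−k) mod n}} = {0, 1}, and let C_j be the cyclotomic coset of j modulo 3^n − 1. Then C_j ⊆ S_1 and |C_j| = n. -/
/-- The `i`-th ternary digit (indices read modulo `n`) of the residue of `j` modulo `3^n - 1`. -/
def dig (n : ℕ) (j : ℤ) (i : ℕ) : ℕ :=
  ((j % ((3 : ℤ) ^ n - 1)).toNat / 3 ^ (i % n)) % 3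

/-- The ternary weight of (the residue modulo `3^n - 1` of) `j`. -/
def wt (n : ℕ) (j : ℤ) : ℕ := ∑ i ∈ Finset.range n, dig n j i

/-- `d = (3^k + 1)/2`. -/
def cmD (k : ℕ) : ℤ := ((3 : ℤ) ^ k + 1) / 2

/-- The set `S_1`. -/
def S1 (n k : ℕ) : Set ℤ :=
  {j | 0 < j ∧ j < 3 ^ n - 1 ∧
    wt n j + wt n (3 ^ k * j) = wt n ((3 ^ k + 1) * j) + 2 ∧
    2 * wt n (-(j * cmD k)) = wt n (-((3 ^ k + 1) * j))}
/-- The cyclotomic coset of `j` modulo `3^n - 1`. -/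
def Ccoset (n : ℕ) (j : ℤ) : Set ℤ :=
  {m | ∃ t : ℕ, t < n ∧ m = (3 ^ t * j) % ((3 : ℤ) ^ n - 1)}

/-- Rotating the ternary digits of `r` by `i` places: a closed form for `3 ^ i * r` modulo
`3 ^ n - 1`. -/
theorem emod_eq_rotate (n i r : ℕ) (hi : i ≤ n) (hr : (r : ℤ) < 3 ^ n - 1) :
    (3 ^ i * (r : ℤ)) % (3 ^ n - 1) =
      ((r % 3 ^ (n - i) * 3 ^ i + r / 3 ^ (n - i) : ℕ) : ℤ) := by
  obtain ⟨m, rfl⟩ := Nat.exists_eq_add_of_le hi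
  rw [Nat.add_sub_cancel_left]
  have hdecomp := Nat.div_add_mod r (3 ^ m)
  have hlo : r % 3 ^ m < 3 ^ m := Nat.mod_lt _ (by positivity)
  have hhi : r / 3 ^ m < 3 ^ i := by
    apply Nat.div_lt_of_lt_mul
    rw [pow_add] at hr
    have : (r : ℤ) < 3 ^ m * 3 ^ i := by linarith
    exact_mod_cast this
  generalize r % 3 ^ m = lo at *
  generalize r / 3 ^ m = hi' at *
  subst hdecomp
  rw [pow_add] at hr ⊢
  push_cast at hr ⊢
  have hlo' : (lo : ℤ) + 1 ≤ 3 ^ m := by exact_mod_cast hlo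
  have hhi' : (hi' : ℤ) + 1 ≤ 3 ^ i := by exact_mod_cast hhi
  have hA : (1 : ℤ) ≤ 3 ^ m := one_le_pow₀ (by norm_num)
  have hB : (1 : ℤ) ≤ 3 ^ i := one_le_pow₀ (by norm_num)
  have hlo0 : (0 : ℤ) ≤ lo := by positivity
  have hhi0 : (0 : ℤ) ≤ hi' := by positivity
  generalize (3 : ℤ) ^ m = A at *
  generalize (3 : ℤ) ^ i = B at *
  generalize (lo : ℤ) = lo at *
  generalize (hi' : ℤ) = hi at *
  have hlt : lo * B + hi < B * A - 1 := by
    rcases eq_or_lt_of_le hlo' with h | h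
    · rcases eq_or_lt_of_le hhi' with h' | h'
      · subst h h'; nlinarith
      · subst h; nlinarith
    · nlinarith
  have hcongr : B * (A * hi + lo) = (lo * B + hi) + (B * A - 1) * hi := by ring
  rw [hcongr, Int.add_mul_emod_self_left, Int.emod_eq_of_lt (by positivity) hlt]

theorem three_mul_emod_step (n i : ℕ) (a : ℤ) (hi : i < n) :
    3 * ((3 ^ i * a) % (3 ^ n - 1)) =
      (3 ^ n - 1) * (dig n a (n - 1 - i) : ℤ) + (3 ^ (i + 1) * a) % (3 ^ n - 1) := by
  have hM : (0 : ℤ) < 3 ^ n - 1 := by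
    have : (1 : ℤ) < 3 ^ n := one_lt_pow₀ (by norm_num) (by omega)
    linarith
  have hred (t : ℕ) : (3 ^ t * a) % ((3 : ℤ) ^ n - 1) =
      (3 ^ t * (a % (3 ^ n - 1))) % (3 ^ n - 1) :=
    ((Int.mod_modEq a _).mul_left _).symm
  rw [hred i, hred (i + 1)]
  unfold dig
  obtain ⟨r, hr⟩ := Int.eq_ofNat_of_zero_le (Int.emod_nonneg a hM.ne')
  have hlt := Int.emod_lt_of_pos a hM
  rw [hr] at hlt ⊢
  rw [emod_eq_rotate n i r hi.le hlt, emod_eq_rotate n (i + 1) r hi hlt]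
  obtain ⟨m, rfl⟩ := Nat.exists_eq_add_of_lt hi
  have e1 : i + m + 1 - i = m + 1 := by omega
  have e2 : i + m + 1 - (i + 1) = m := by omega
  have e3 : (i + m + 1 - 1 - i) % (i + m + 1) = m := by
    rw [Nat.mod_eq_of_lt] <;> omega
  rw [e1, e2, e3, Int.toNat_natCast, Nat.mod_pow_succ, pow_succ 3 m, ← Nat.div_div_eq_div_mul]
  have h := Nat.div_add_mod (r / 3 ^ m) 3
  have h' : ((r / 3 ^ m : ℕ) : ℤ) = 3 * (r / 3 ^ m / 3 : ℕ) + (r / 3 ^ m % 3 : ℕ) := by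
    exact_mod_cast h.symm
  generalize r / 3 ^ m = q at *
  generalize q / 3 = u at *
  generalize q % 3 = v at *
  generalize r % 3 ^ m = w at *
  push_cast
  rw [h']
  ring

theorem three_pow_modEq_one (n : ℕ) : (3 : ℤ) ^ n ≡ 1 [ZMOD 3 ^ n - 1] :=
  (Int.modEq_iff_dvd.mpr dvd_rfl).symm

theorem three_pow_mul_emod (n : ℕ) (a : ℤ) :
    (3 ^ n * a) % ((3 : ℤ) ^ n - 1) = (3 ^ 0 * a) % ((3 : ℤ) ^ n - 1) :=
  (three_pow_modEq_one n).mul_right a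

theorem mul_wt_eq_sum (n : ℕ) (a : ℤ) :
    ((3 : ℤ) ^ n - 1) * (wt n a : ℤ) =
      2 * ∑ i ∈ Finset.range n, (3 ^ i * a) % ((3 : ℤ) ^ n - 1) := by
  have hsum : ∑ i ∈ Finset.range n, 3 * ((3 ^ i * a) % ((3 : ℤ) ^ n - 1)) =
      ∑ i ∈ Finset.range n, ((3 ^ n - 1) * (dig n a (n - 1 - i) : ℤ) +
        (3 ^ (i + 1) * a) % ((3 : ℤ) ^ n - 1)) :=
    Finset.sum_congr rfl fun i hi => three_mul_emod_step n i a (Finset.mem_range.mp hi)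
  have hshift := Finset.sum_range_succ' (fun i => (3 ^ i * a) % ((3 : ℤ) ^ n - 1)) n
  rw [Finset.sum_range_succ, three_pow_mul_emod] at hshift
  rw [Finset.sum_add_distrib, ← Finset.mul_sum, ← Finset.mul_sum,
    Finset.sum_range_reflect (fun i => (dig n a i : ℤ)) n] at hsum
  unfold wt
  push_cast
  linarith

theorem wt_congr (n : ℕ) {a b : ℤ} (h : a ≡ b [ZMOD 3 ^ n - 1]) : wt n a = wt n b := by
  unfold wt dig
  rw [h]

theorem wt_three_mul (n : ℕ) (hn : 0 < n) (a : ℤ) : wt n (3 * a) = wt n a := by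
  have hM : (0 : ℤ) < 3 ^ n - 1 := by
    have : (1 : ℤ) < 3 ^ n := one_lt_pow₀ (by norm_num) (by omega)
    linarith
  have h : ((3 : ℤ) ^ n - 1) * (wt n (3 * a) : ℤ) = (3 ^ n - 1) * (wt n a : ℤ) := by
    rw [mul_wt_eq_sum, mul_wt_eq_sum]
    have hshift := Finset.sum_range_succ' (fun i => (3 ^ i * a) % ((3 : ℤ) ^ n - 1)) n
    rw [Finset.sum_range_succ, three_pow_mul_emod] at hshift
    simp only [← mul_assoc, ← pow_succ]
    linarith
  exact_mod_cast mul_left_cancel₀ hM.ne' h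

theorem wt_three_pow_mul (n : ℕ) (hn : 0 < n) (t : ℕ) (a : ℤ) : wt n (3 ^ t * a) = wt n a := by
  induction t with
  | zero => simp
  | succ t ih => rw [pow_succ', mul_assoc, wt_three_mul n hn, ih]

theorem isCoprime_three_pow (n t : ℕ) (hn : 0 < n) : IsCoprime ((3 : ℤ) ^ n - 1) (3 ^ t) := by
  apply IsCoprime.pow_right
  obtain ⟨m, rfl⟩ := Nat.exists_eq_succ_of_ne_zero hn.ne'
  exact ⟨-1, 3 ^ m, by rw [pow_succ]; ring⟩

theorem emod_add_emod_eq (M a b : ℤ) (hM : 0 < M) :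
    a % M + b % M = (a + b) % M + M * (if M ≤ a % M + b % M then 1 else 0) := by
  have ha := Int.emod_nonneg a hM.ne'
  have hb := Int.emod_nonneg b hM.ne'
  have ha' := Int.emod_lt_of_pos a hM
  have hb' := Int.emod_lt_of_pos b hM
  rw [Int.add_emod a b]
  generalize a % M = a at *
  generalize b % M = b at *
  split_ifs with h
  · rw [← Int.sub_emod_right, Int.emod_eq_of_lt] <;> linarith
  · rw [Int.emod_eq_of_lt] <;> linarith

/-- Each carry in the cyclic addition of `a` and `b` lowers the ternary weight by two. -/
theorem wt_add_wt_eq (n : ℕ) (hn : 0 < n) (a b : ℤ) :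
    wt n a + wt n b = wt n (a + b) + 2 * ((Finset.range n).filter fun i =>
      (3 : ℤ) ^ n - 1 ≤ (3 ^ i * a) % (3 ^ n - 1) + (3 ^ i * b) % (3 ^ n - 1)).card := by
  have hM : (0 : ℤ) < 3 ^ n - 1 := by
    have : (1 : ℤ) < 3 ^ n := one_lt_pow₀ (by norm_num) (by omega)
    linarith
  have hsum := Finset.sum_congr rfl fun i (_ : i ∈ Finset.range n) =>
    emod_add_emod_eq ((3 : ℤ) ^ n - 1) (3 ^ i * a) (3 ^ i * b) hM
  simp only [← mul_add] at hsum
  rw [Finset.sum_add_distrib, Finset.sum_add_distrib, ← Finset.mul_sum, Finset.sum_boole] at hsum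
  have ha := mul_wt_eq_sum n a
  have hb := mul_wt_eq_sum n b
  have hab := mul_wt_eq_sum n (a + b)
  zify
  apply mul_left_cancel₀ hM.ne'
  linarith

/-- If the cyclic addition of `j` and `3 ^ k * j` has exactly one carry, then the digits of `j`
have no period shorter than `n`. -/
theorem not_modEq_of_wt (n k : ℕ) (hn : 0 < n) (j : ℤ)
    (hw : wt n j + wt n (3 ^ k * j) = wt n ((3 ^ k + 1) * j) + 2) (p : ℕ) (hp0 : 0 < p)
    (hpn : p < n) : ¬ 3 ^ p * j ≡ j [ZMOD 3 ^ n - 1] := by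
  intro hper
  have hcard := wt_add_wt_eq n hn j (3 ^ k * j)
  rw [hw, show j + 3 ^ k * j = (3 ^ k + 1) * j by ring] at hcard
  obtain ⟨i, hi⟩ := Finset.card_eq_one.mp (by omega : ((Finset.range n).filter fun i =>
    (3 : ℤ) ^ n - 1 ≤ (3 ^ i * j) % (3 ^ n - 1) + (3 ^ i * (3 ^ k * j)) % (3 ^ n - 1)).card = 1)
  have hmem := Finset.mem_singleton_self i
  rw [← hi, Finset.mem_filter, Finset.mem_range] at hmem
  have hmod : (3 : ℤ) ^ ((i + p) % n) * j ≡ 3 ^ i * j [ZMOD 3 ^ n - 1] := by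
    have h1 : (3 : ℤ) ^ (i + p) ≡ 3 ^ ((i + p) % n) [ZMOD 3 ^ n - 1] := by
      conv_lhs => rw [← Nat.mod_add_div (i + p) n, pow_add, pow_mul]
      simpa using ((three_pow_modEq_one n).pow ((i + p) / n)).mul_left (3 ^ ((i + p) % n))
    refine (h1.symm.mul_right j).trans ?_
    rw [pow_add, mul_assoc]
    exact hper.mul_left _
  have hmod' : (3 : ℤ) ^ ((i + p) % n) * (3 ^ k * j) ≡ 3 ^ i * (3 ^ k * j) [ZMOD 3 ^ n - 1] := by
    rw [mul_left_comm, mul_left_comm (3 ^ i)]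
    exact hmod.mul_left _
  have hmem' : (i + p) % n ∈ ((Finset.range n).filter fun i =>
      (3 : ℤ) ^ n - 1 ≤ (3 ^ i * j) % (3 ^ n - 1) + (3 ^ i * (3 ^ k * j)) % (3 ^ n - 1)) := by
    rw [Finset.mem_filter, Finset.mem_range, hmod, hmod']
    exact ⟨Nat.mod_lt _ hn, hmem.2⟩
  rw [hi, Finset.mem_singleton] at hmem'
  rcases lt_or_ge (i + p) n with h | h
  · rw [Nat.mod_eq_of_lt h] at hmem'
    omega
  · rw [Nat.mod_eq_sub_mod h, Nat.mod_eq_of_lt (by omega)] at hmem'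
    omega

theorem Ccoset_subset_S1 (n k : ℕ) (hn : 0 < n) (j : ℤ) (hj : j ∈ S1 n k) :
    Ccoset n j ⊆ S1 n k := by
  obtain ⟨hj0, hjM, hw, hw'⟩ := hj
  have hM : (0 : ℤ) < 3 ^ n - 1 := hj0.trans hjM
  rintro m ⟨t, -, rfl⟩
  have hm : (3 ^ t * j) % ((3 : ℤ) ^ n - 1) ≡ 3 ^ t * j [ZMOD 3 ^ n - 1] := Int.mod_modEq _ _
  generalize hm' : (3 ^ t * j) % ((3 : ℤ) ^ n - 1) = m at hm ⊢
  have hwt (c : ℤ) : wt n (c * m) = wt n (c * j) := by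
    rw [wt_congr n (hm.mul_left c), mul_left_comm, wt_three_pow_mul n hn]
  refine ⟨?_, hm' ▸ Int.emod_lt_of_pos _ hM, ?_, ?_⟩
  · refine lt_of_le_of_ne (hm' ▸ Int.emod_nonneg _ hM.ne') fun h => ?_
    have hdvd : (3 : ℤ) ^ n - 1 ∣ j :=
      (isCoprime_three_pow n t hn).dvd_of_dvd_mul_left (Int.dvd_of_emod_eq_zero (hm'.trans h.symm))
    exact absurd (Int.le_of_dvd hj0 hdvd) (not_le.mpr hjM)
  · have h := hwt 1
    rw [one_mul, one_mul] at h
    rw [h, hwt, hwt, hw]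
  · have h1 := hwt (-cmD k)
    have h2 := hwt (-(3 ^ k + 1))
    rw [neg_mul, neg_mul, mul_comm _ m, mul_comm _ j] at h1
    rw [neg_mul, neg_mul] at h2
    rw [h1, h2, hw']

theorem ncard_Ccoset (n k : ℕ) (hn : 0 < n) (j : ℤ)
    (hw : wt n j + wt n (3 ^ k * j) = wt n ((3 ^ k + 1) * j) + 2) :
    (Ccoset n j).ncard = n := by
  have himage : Ccoset n j =
      (fun t : ℕ => (3 ^ t * j) % ((3 : ℤ) ^ n - 1)) '' (Finset.range n : Set ℕ) := by
    ext m
    simp [Ccoset, eq_comm]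
  have hne (s t : ℕ) (hst : s < t) (ht : t < n) :
      ¬ 3 ^ s * j ≡ 3 ^ t * j [ZMOD 3 ^ n - 1] := by
    intro h
    obtain ⟨p, rfl⟩ := Nat.exists_eq_add_of_le hst.le
    refine not_modEq_of_wt n k hn j hw p (by omega) (by omega) (Int.modEq_iff_dvd.mpr ?_).symm
    refine (isCoprime_three_pow n s hn).dvd_of_dvd_mul_left ?_
    have e : (3 : ℤ) ^ s * (3 ^ p * j - j) = 3 ^ (s + p) * j - 3 ^ s * j := by ring
    exact e ▸ Int.modEq_iff_dvd.mp h
  rw [himage, Set.InjOn.ncard_image, Set.ncard_coe_finset, Finset.card_range]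
  intro s hs t ht hst
  rw [Finset.mem_coe, Finset.mem_range] at hs ht
  rcases lt_trichotomy s t with h | h | h
  · exact (hne s t h ht hst).elim
  · exact h
  · exact (hne t s h hs hst.symm).elim

theorem stmt11 (n k : ℕ) (hn : 2 ≤ n) (hkodd : Odd k) (hk0 : 0 < k) (hkn : k < n)
    (hgcd : Nat.gcd n k = 1) (j : ℤ) (hj : j ∈ S1 n k)
    (h0 : (dig n j 0 = 1 ∧ dig n j (n - k) = 2) ∨ (dig n j 0 = 2 ∧ dig n j (n - k) = 1))
    (h1 : (dig n j 1 = 0 ∧ dig n j (n - k + 1) = 1) ∨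
      (dig n j 1 = 1 ∧ dig n j (n - k + 1) = 0)) :
    Ccoset n j ⊆ S1 n k ∧ (Ccoset n j).ncard = n := by
  exact ⟨Ccoset_subset_S1 n k (by omega) j hj, ncard_Ccoset n k (by omega) j hj.2.2.1⟩
end

section
/- For every j ∈ S_1, σ(j)·σ(−jd) = 2^{N_2(j)}. -/
/-- `N_2(j)`: the number of ternary digits of (the residue of) `j` equal to 2. -/
def N2 (n : ℕ) (j : ℤ) : ℕ := ((Finset.range n).filter (fun i => dig n j i = 2)).card

/-- `σ(j)`: the product of the factorials of the ternary digits of (the residue of) `j`. -/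
def sigmaFac (n : ℕ) (j : ℤ) : ℕ := ∏ i ∈ Finset.range n, Nat.factorial (dig n j i)

/-- The truncated base-3 Legendre formula. -/
theorem sum_ternary_digits_add (x n : ℕ) :
    ∑ i ∈ Finset.range n, x / 3 ^ i % 3 + 2 * ∑ i ∈ Finset.range n, x / 3 ^ (i + 1) + x / 3 ^ n
      = x := by
  induction n with
  | zero => simp
  | succ n ih =>
    rw [Finset.sum_range_succ, Finset.sum_range_succ]
    have h : x / 3 ^ (n + 1) = x / 3 ^ n / 3 := by rw [pow_succ, Nat.div_div_eq_div_mul]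
    omega

/-- If doubling `a` cyclically (with incoming carry `c` equal to the outgoing one) exactly doubles
the ternary digit sum, then `a` has no ternary digit equal to `2`. -/
theorem ternary_digit_ne_two {a c n : ℕ} (ha : a < 3 ^ n) (hc : (2 * a + c) / 3 ^ n = c)
    (h : 2 * ∑ i ∈ Finset.range n, a / 3 ^ i % 3
      = ∑ i ∈ Finset.range n, (2 * a + c) / 3 ^ i % 3) {i : ℕ} (hi : i < n) :
    a / 3 ^ i % 3 ≠ 2 := by
  have double_div_le (m : ℕ) : 2 * (a / 3 ^ m) ≤ (2 * a + c) / 3 ^ m := by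
    rw [Nat.le_div_iff_mul_le (by positivity)]
    have := Nat.div_mul_le_self a (3 ^ m)
    linarith
  have hA := sum_ternary_digits_add a n
  have hE := sum_ternary_digits_add (2 * a + c) n
  rw [Nat.div_eq_of_lt ha] at hA
  have hsum : ∑ i ∈ Finset.range n, 2 * (a / 3 ^ (i + 1))
      = ∑ i ∈ Finset.range n, (2 * a + c) / 3 ^ (i + 1) := by
    rw [← Finset.mul_sum]
    omega
  have heq := (Finset.sum_eq_sum_iff_of_le fun m _ => double_div_le (m + 1)).1 hsum i
    (Finset.mem_range.2 hi)
  have hle := double_div_le i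
  rw [pow_succ, ← Nat.div_div_eq_div_mul, ← Nat.div_div_eq_div_mul] at heq
  omega

theorem add_three_pow_digit {i n : ℕ} (b : ℕ) (hi : i < n) :
    (b + 3 ^ n) / 3 ^ i % 3 = b / 3 ^ i % 3 := by
  obtain ⟨t, rfl⟩ := Nat.exists_eq_add_of_lt hi
  have h : b + 3 ^ (i + t + 1) = b + 3 ^ i * (3 * 3 ^ t) := by ring
  rw [h, Nat.add_mul_div_left _ _ (by positivity)]
  omega

theorem wt_eq_sum (n : ℕ) (j : ℤ) :
    wt n j = ∑ i ∈ Finset.range n, (j % ((3 : ℤ) ^ n - 1)).toNat / 3 ^ i % 3 :=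
  Finset.sum_congr rfl fun i hi => by rw [dig, Nat.mod_eq_of_lt (Finset.mem_range.1 hi)]

theorem dig_ne_two_of_two_mul_wt_eq {n : ℕ} (hn : n ≠ 0) {m : ℤ} (h : 2 * wt n m = wt n (2 * m))
    {i : ℕ} (hi : i < n) : dig n m i ≠ 2 := by
  rw [dig, Nat.mod_eq_of_lt hi]
  have hM : (3 : ℤ) ≤ 3 ^ n := le_self_pow₀ (by norm_num) hn
  rw [wt_eq_sum, wt_eq_sum, ← (Int.ModEq.mul_left 2 (Int.mod_modEq m (3 ^ n - 1))).eq] at h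
  have h0 := Int.emod_nonneg m (b := (3 : ℤ) ^ n - 1) (by omega)
  have h1 := Int.emod_lt_of_pos m (b := (3 : ℤ) ^ n - 1) (by omega)
  obtain ⟨a, ha⟩ := Int.eq_ofNat_of_zero_le h0
  rw [ha] at h h1 ⊢
  rw [Int.toNat_natCast] at h ⊢
  have hcast : ((3 ^ n : ℕ) : ℤ) = 3 ^ n := by push_cast; rfl
  rcases lt_or_ge (2 * (a : ℤ)) (3 ^ n - 1) with hlt | hge
  · rw [Int.emod_eq_of_lt (by omega) hlt] at h
    have htoNat : (2 * (a : ℤ)).toNat = 2 * a + 0 := by omega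
    rw [htoNat] at h
    exact ternary_digit_ne_two (by omega) (Nat.div_eq_of_lt (by omega)) h hi
  · have hmod : 2 * (a : ℤ) % (3 ^ n - 1) = 2 * a - (3 ^ n - 1) := by
      rw [← Int.sub_emod_right, Int.emod_eq_of_lt (by omega) (by omega)]
    rw [hmod] at h
    obtain ⟨b, hb⟩ : ∃ b : ℕ, 2 * a + 1 = b + 3 ^ n := ⟨2 * a + 1 - 3 ^ n, by omega⟩
    have htoNat : (2 * (a : ℤ) - (3 ^ n - 1)).toNat = b := by omega
    rw [htoNat] at h
    refine ternary_digit_ne_two (c := 1) (by omega) ?_ (h.trans ?_) hi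
    · rw [hb, Nat.add_div_right _ (by positivity), Nat.div_eq_of_lt (by omega)]
    · refine Finset.sum_congr rfl fun i hi => ?_
      rw [hb, add_three_pow_digit b (Finset.mem_range.1 hi)]

theorem sigmaFac_eq_two_pow_N2 (n : ℕ) (j : ℤ) : sigmaFac n j = 2 ^ N2 n j := by
  rw [sigmaFac, N2, Finset.card_filter, ← Finset.prod_pow_eq_pow_sum]
  refine Finset.prod_congr rfl fun i _ => ?_
  have h : dig n j i < 3 := Nat.mod_lt _ (by norm_num)
  interval_cases dig n j i <;> rfl

theorem two_mul_cmD (k : ℕ) : 2 * cmD k = 3 ^ k + 1 :=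
  Int.mul_ediv_cancel' (Odd.add_one (Odd.pow (by decide))).two_dvd

theorem stmt14 (n k : ℕ) (hn : 2 ≤ n) (hkodd : Odd k) (hk0 : 0 < k) (hkn : k < n)
    (hgcd : Nat.gcd n k = 1) (j : ℤ) (hj : j ∈ S1 n k) :
    sigmaFac n j * sigmaFac n (-(j * cmD k)) = 2 ^ (N2 n j) := by
  obtain ⟨-, -, -, hwt⟩ := hj
  have hdouble : -((3 ^ k + 1) * j) = 2 * -(j * cmD k) := by
    rw [← two_mul_cmD]
    ring
  rw [hdouble] at hwt
  have hN2 : N2 n (-(j * cmD k)) = 0 := by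
    rw [N2, Finset.card_eq_zero, Finset.filter_eq_empty_iff]
    exact fun i hi => dig_ne_two_of_two_mul_wt_eq (by omega) hwt (Finset.mem_range.1 hi)
  rw [sigmaFac_eq_two_pow_N2, sigmaFac_eq_two_pow_N2, hN2, pow_zero, mul_one]
end
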